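/- The Alladi–Andrews–Gordon Key Identity: for nonnegative integers i, j, k, the sum over nonnegative integers a, b, c, ab, ac, bc satisfying i = a + ab + ac, j = b + ab + bc, k = c + ac + bc, of q^{T_t + T_{ab} + T_{ac} + T_{bc-1}} · (1 - q^a + q^{a+bc}) / ((q)_a (q)_b (q)_c (q)_{ab} (q)_{ac} (q)_{bc}), where t = a+b+c+ab+ac+bc, equals q^{T_i + T_j + T_k} / ((q)_i (q)_j (q)_k), as formal power series in q. -/

import Mathlib

open Finset PowerSeries

/-- Triangular number `T m = m(m+1)/2` (natural number version). -/
def T (m : ℕ) : ℕ := m * (m + 1) / 2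

/-- `(q)_n = (q;q)_n = ∏_{r=1}^n (1 - q^r)` as a formal power series in `q = X`. -/
noncomputable def qpoch (n : ℕ) : PowerSeries ℚ :=
  ∏ r ∈ Finset.range n, (1 - (X : PowerSeries ℚ) ^ (r + 1))


namespace KeyAux

variable {K : Type*} [Field K]

/-- integer triangular numbers -/
def TZ (n : ℤ) : ℤ := n * (n + 1) / 2

/-- `1/(q)_n`, extended by zero to negative `n` -/
noncomputable def e (q : K) (n : ℤ) : K :=
  if n < 0 then 0 else (∏ r ∈ Finset.range n.toNat, (1 - q ^ (r + 1)))⁻¹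

/-- `q^{T_n}` -/
noncomputable def w (q : K) (n : ℤ) : K := q ^ (TZ n)

lemma TZ_pred (n : ℤ) : TZ n = n + TZ (n - 1) := by
  unfold TZ
  have : n * (n + 1) = (n - 1) * (n - 1 + 1) + n * 2 := by ring
  rw [this, Int.add_mul_ediv_right _ _ (by norm_num)]
  ring

lemma w_pred (q : K) (hq : q ≠ 0) (n : ℤ) : w q (n - 1) = w q n * (q ^ n)⁻¹ := by
  unfold w
  rw [TZ_pred n, zpow_add₀ hq]
  field_simp

lemma e_neg (q : K) {n : ℤ} (h : n < 0) : e q n = 0 := by simp [e, h]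

lemma e_pred (q : K) (h1 : ∀ n : ℕ, 0 < n → q ^ n ≠ 1) (n : ℤ) :
    e q (n - 1) = (1 - q ^ n) * e q n := by
  rcases lt_trichotomy n 0 with h | h | h
  · rw [e_neg q h, e_neg q (by omega)]; simp
  · subst h; rw [e_neg q (by norm_num)]; simp
  · obtain ⟨m, rfl⟩ : ∃ m : ℕ, n = m + 1 := ⟨(n - 1).toNat, by omega⟩
    have e1 : ((m : ℤ) + 1).toNat = m + 1 := by omega
    have h3 : ¬ ((m : ℤ) + 1 < 0) := by omega
    have h4 : (1 - q ^ (m + 1)) ≠ 0 := sub_ne_zero.2 (h1 (m + 1) (by omega)).symm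
    simp only [e, add_sub_cancel_right, e1, h3, if_false, Finset.prod_range_succ]
    rw [if_neg (by omega)]
    have h5 : q ^ ((m : ℤ) + 1) = q ^ (m + 1) := by exact_mod_cast zpow_natCast q (m + 1)
    rw [h5, mul_inv, Int.toNat_natCast]
    field_simp

lemma e_zero (q : K) : e q 0 = 1 := by simp [e]

/-- summand of the auxiliary series -/
noncomputable def r (q : K) (a b c x y z t : ℤ) : K :=
  w q t * e q a * e q b * e q c * (w q x * q ^ x * e q x) * (w q y * q ^ y * e q y) *
    (w q z * e q z)

/-- summand of the left-hand side -/
noncomputable def S (q : K) (a b c x y z t : ℤ) : K :=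
  w q t * w q x * w q y * w q (z - 1) * (1 - q ^ a + q ^ (a + z)) *
    (e q a * e q b * e q c * e q x * e q y * e q z)

lemma e_pred2 (q : K) (hq : q ≠ 0) (h1 : ∀ n : ℕ, 0 < n → q ^ n ≠ 1) (n : ℤ) :
    e q (n - 2) = (1 - q ^ n / q) * ((1 - q ^ n) * e q n) := by
  rw [show n - 2 = n - 1 - 1 by ring, e_pred q h1, e_pred q h1, zpow_sub_one₀ hq, div_eq_mul_inv]

lemma e_pred3 (q : K) (hq : q ≠ 0) (h1 : ∀ n : ℕ, 0 < n → q ^ n ≠ 1) (n : ℤ) :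
    e q (n - 3) = (1 - q ^ n / q / q) * ((1 - q ^ n / q) * ((1 - q ^ n) * e q n)) := by
  rw [show n - 3 = n - 1 - 2 by ring, e_pred2 q hq h1, e_pred q h1, zpow_sub_one₀ hq]
  simp only [div_eq_mul_inv]

lemma termwise (q : K) (hq : q ≠ 0) (h1 : ∀ n : ℕ, 0 < n → q ^ n ≠ 1) (a b c x y z i t : ℤ)
    (hi : i = a + x + y) (ht : t = a + b + c + x + y + z) :
    (1 - q ^ i) * S q a b c x y z t - q ^ i * S q (a - 1) b c x y z (t - 1) =
      q * ((r q a b c (x - 1) y z t - r q (a - 1) b c (x - 1) y z t) -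
        (r q (a - 1) (b - 1) c x y z (t - 1) - r q (a - 2) (b - 1) c x y z (t - 1))) +
      q * ((r q a b c x (y - 1) z t - r q (a - 1) b c x (y - 1) z t) -
        (r q (a - 1) b (c - 1) x y z (t - 1) - r q (a - 2) b (c - 1) x y z (t - 1))) -
      q * ((r q (a - 1) b c x y (z - 1) t - r q (a - 2) b c x y (z - 1) t) -
        (r q (a - 1) (b - 1) (c - 1) x y z (t - 1) -
          r q (a - 2) (b - 1) (c - 1) x y z (t - 1))) +
      q ^ 2 * ((r q a b c (x - 1) (y - 1) z t - r q (a - 1) b c (x - 1) (y - 1) z t) -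
        (r q (a - 2) b c x y (z - 1) (t - 1) - r q (a - 3) b c x y (z - 1) (t - 1))) := by
  have hwt : w q (t - 1) = w q t * (q ^ a * q ^ b * q ^ c * q ^ x * q ^ y * q ^ z)⁻¹ := by
    rw [w_pred q hq, ht]; simp only [zpow_add₀ hq]
  subst hi
  unfold S r
  simp only [hwt, w_pred q hq, e_pred3 q hq h1, e_pred2 q hq h1, e_pred q h1, zpow_add₀ hq,
    zpow_sub_one₀ hq]
  have ha : q ^ a ≠ 0 := zpow_ne_zero _ hq
  have hb : q ^ b ≠ 0 := zpow_ne_zero _ hq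
  have hc : q ^ c ≠ 0 := zpow_ne_zero _ hq
  have hx : q ^ x ≠ 0 := zpow_ne_zero _ hq
  have hy : q ^ y ≠ 0 := zpow_ne_zero _ hq
  have hz : q ^ z ≠ 0 := zpow_ne_zero _ hq
  generalize q ^ a = A at *
  generalize q ^ b = B at *
  generalize q ^ c = C at *
  generalize q ^ x = X at *
  generalize q ^ y = Y at *
  generalize q ^ z = Z at *
  generalize e q a = ea
  generalize e q b = eb
  generalize e q c = ec
  generalize e q x = ex
  generalize e q y = ey
  generalize e q z = ez
  generalize w q t = wt
  generalize w q x = wx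
  generalize w q y = wy
  generalize w q z = wz
  field_simp
  ring

lemma termwise2 (q : K) (hq : q ≠ 0) (h1 : ∀ n : ℕ, 0 < n → q ^ n ≠ 1) (b c z k t : ℤ)
    (hk : k = c + z) (ht : t = b + c + z) :
    (1 - q ^ k) * (w q t * w q z * (e q b * e q c * e q z)) -
        q ^ k * (w q (t - 1) * w q z * (e q b * e q (c - 1) * e q z)) =
      q * ((w q t * (w q (z - 1) * q ^ (z - 1) * e q (z - 1)) * (e q b * e q c) -
           w q t * (w q (z - 1) * q ^ (z - 1) * e q (z - 1)) * (e q b * e q (c - 1))) -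
        (w q (t - 1) * (w q z * q ^ z * e q z) * (e q (b - 1) * e q (c - 1)) -
           w q (t - 1) * (w q z * q ^ z * e q z) * (e q (b - 1) * e q (c - 2)))) := by
  have hwt : w q (t - 1) = w q t * (q ^ b * q ^ c * q ^ z)⁻¹ := by
    rw [w_pred q hq, ht]; simp only [zpow_add₀ hq]
  subst hk
  simp only [hwt, w_pred q hq, e_pred2 q hq h1, e_pred q h1, zpow_add₀ hq, zpow_sub_one₀ hq]
  have hb : q ^ b ≠ 0 := zpow_ne_zero _ hq
  have hc : q ^ c ≠ 0 := zpow_ne_zero _ hq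
  have hz : q ^ z ≠ 0 := zpow_ne_zero _ hq
  generalize q ^ b = B at *
  generalize q ^ c = C at *
  generalize q ^ z = Z at *
  field_simp
  ring

lemma mul_finsum' {f : ℤ × ℤ × ℤ → K} (hf : (Function.support f).Finite) {c : K} :
    c * ∑ᶠ p, f p = ∑ᶠ p, c * f p := by
  simpa only [smul_eq_mul] using smul_finsum' c hf

lemma e_ne (q : K) {n : ℤ} (h : e q n ≠ 0) : 0 ≤ n := by
  by_contra hn
  exact h (e_neg q (by omega))

lemma r_ne (q : K) {a b c x y z t : ℤ} (h : r q a b c x y z t ≠ 0) :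
    0 ≤ a ∧ 0 ≤ b ∧ 0 ≤ c ∧ 0 ≤ x ∧ 0 ≤ y ∧ 0 ≤ z := by
  unfold r at h
  simp only [ne_eq, mul_eq_zero, not_or] at h
  obtain ⟨⟨⟨⟨⟨⟨_, ha⟩, hb⟩, hc⟩, _, hx⟩, _, hy⟩, _, hz⟩ := h
  exact ⟨e_ne q ha, e_ne q hb, e_ne q hc, e_ne q hx, e_ne q hy, e_ne q hz⟩

lemma S_ne (q : K) {a b c x y z t : ℤ} (h : S q a b c x y z t ≠ 0) :
    0 ≤ a ∧ 0 ≤ b ∧ 0 ≤ c ∧ 0 ≤ x ∧ 0 ≤ y ∧ 0 ≤ z := by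
  unfold S at h
  simp only [ne_eq, mul_eq_zero, not_or] at h
  obtain ⟨_, ⟨⟨⟨⟨ha, hb⟩, hc⟩, hx⟩, hy⟩, hz⟩ := h
  exact ⟨e_ne q ha, e_ne q hb, e_ne q hc, e_ne q hx, e_ne q hy, e_ne q hz⟩

lemma fin_supp (f : ℤ × ℤ × ℤ → K) (N : ℤ)
    (h : ∀ x y z, f (x, y, z) ≠ 0 → -N ≤ x ∧ x ≤ N ∧ -N ≤ y ∧ y ≤ N ∧ -N ≤ z ∧ z ≤ N) :
    (Function.support f).Finite := by
  refine (Set.finite_Icc ((-N, -N, -N) : ℤ × ℤ × ℤ) (N, N, N)).subset ?_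
  rintro ⟨x, y, z⟩ hp
  have := h x y z hp
  simp only [Set.mem_Icc, Prod.mk_le_mk]
  tauto

lemma fin_supp_shift {f : ℤ × ℤ × ℤ → K} (hf : (Function.support f).Finite) (v : ℤ × ℤ × ℤ) :
    (Function.support fun p => f (p + v)).Finite :=
  hf.preimage (f := fun p => p + v) (fun _ _ _ _ h => add_right_cancel h)

lemma fin_supp_diff {f : ℤ × ℤ × ℤ → K} (hf : (Function.support f).Finite) (v : ℤ × ℤ × ℤ)
    (c : K) : (Function.support fun p => c * (f p - f (p + v))).Finite := by
  refine (hf.union (fin_supp_shift hf v)).subset ?_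
  intro p hp
  by_contra hn
  simp only [Set.mem_union, Function.mem_support, not_or, not_not] at hn
  exact hp (by simp [hn.1, hn.2])

lemma finsum_diff {f : ℤ × ℤ × ℤ → K} (hf : (Function.support f).Finite) (v : ℤ × ℤ × ℤ)
    (c : K) : ∑ᶠ p, c * (f p - f (p + v)) = 0 := by
  have h2 : ∑ᶠ p, f (p + v) = ∑ᶠ p, f p := finsum_comp_equiv (Equiv.addRight v)
  have h3 : (Function.support fun p => f p - f (p + v)).Finite := by
    simpa using fin_supp_diff hf v 1
  rw [← mul_finsum' h3, finsum_sub_distrib hf (fin_supp_shift hf v), h2, sub_self, mul_zero]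

/-- summand as a function of the triple -/
noncomputable def s (q : K) (i j k : ℤ) (p : ℤ × ℤ × ℤ) : K :=
  S q (i - p.1 - p.2.1) (j - p.1 - p.2.2) (k - p.2.1 - p.2.2) p.1 p.2.1 p.2.2
    (i + j + k - p.1 - p.2.1 - p.2.2)

lemma s_fin (q : K) (i j k : ℤ) : (Function.support (s q i j k)).Finite := by
  refine fin_supp _ (|i| + |j| + |k|) ?_
  intro x y z h
  have := S_ne q h
  have := le_abs_self i
  have := le_abs_self j
  have := le_abs_self k
  have := abs_nonneg i
  have := abs_nonneg j
  have := abs_nonneg k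
  simp only at *
  omega

noncomputable def g1 (q : K) (i j k : ℤ) (p : ℤ × ℤ × ℤ) : K :=
  r q (i - p.1 - p.2.1) (j - p.1 - p.2.2) (k - p.2.1 - p.2.2) (p.1 - 1) p.2.1 p.2.2
    (i + j + k - p.1 - p.2.1 - p.2.2) -
  r q (i - p.1 - p.2.1 - 1) (j - p.1 - p.2.2) (k - p.2.1 - p.2.2) (p.1 - 1) p.2.1 p.2.2
    (i + j + k - p.1 - p.2.1 - p.2.2)

noncomputable def g2 (q : K) (i j k : ℤ) (p : ℤ × ℤ × ℤ) : K :=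
  r q (i - p.1 - p.2.1) (j - p.1 - p.2.2) (k - p.2.1 - p.2.2) p.1 (p.2.1 - 1) p.2.2
    (i + j + k - p.1 - p.2.1 - p.2.2) -
  r q (i - p.1 - p.2.1 - 1) (j - p.1 - p.2.2) (k - p.2.1 - p.2.2) p.1 (p.2.1 - 1) p.2.2
    (i + j + k - p.1 - p.2.1 - p.2.2)

noncomputable def g3 (q : K) (i j k : ℤ) (p : ℤ × ℤ × ℤ) : K :=
  r q (i - p.1 - p.2.1 - 1) (j - p.1 - p.2.2) (k - p.2.1 - p.2.2) p.1 p.2.1 (p.2.2 - 1)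
    (i + j + k - p.1 - p.2.1 - p.2.2) -
  r q (i - p.1 - p.2.1 - 2) (j - p.1 - p.2.2) (k - p.2.1 - p.2.2) p.1 p.2.1 (p.2.2 - 1)
    (i + j + k - p.1 - p.2.1 - p.2.2)

noncomputable def g4 (q : K) (i j k : ℤ) (p : ℤ × ℤ × ℤ) : K :=
  r q (i - p.1 - p.2.1) (j - p.1 - p.2.2) (k - p.2.1 - p.2.2) (p.1 - 1) (p.2.1 - 1) p.2.2
    (i + j + k - p.1 - p.2.1 - p.2.2) -
  r q (i - p.1 - p.2.1 - 1) (j - p.1 - p.2.2) (k - p.2.1 - p.2.2) (p.1 - 1) (p.2.1 - 1) p.2.2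
    (i + j + k - p.1 - p.2.1 - p.2.2)

lemma sub_ne_cases {u v : K} (h : u - v ≠ 0) : u ≠ 0 ∨ v ≠ 0 := by
  by_contra hn
  push Not at hn
  exact h (by simp [hn.1, hn.2])

lemma g_fin (q : K) (i j k : ℤ) : (Function.support (g1 q i j k)).Finite ∧
    (Function.support (g2 q i j k)).Finite ∧ (Function.support (g3 q i j k)).Finite ∧
    (Function.support (g4 q i j k)).Finite := by
  have := le_abs_self i
  have := le_abs_self j
  have := le_abs_self k
  have := abs_nonneg i
  have := abs_nonneg j
  have := abs_nonneg k
  refine ⟨?_, ?_, ?_, ?_⟩ <;>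
  · refine fin_supp _ (|i| + |j| + |k| + 5) ?_
    intro x y z h
    rcases sub_ne_cases h with h | h <;>
    · have := r_ne q h
      simp only at *
      omega

lemma s_step (q : K) (hq : q ≠ 0) (h1 : ∀ n : ℕ, 0 < n → q ^ n ≠ 1) (i j k : ℤ)
    (p : ℤ × ℤ × ℤ) : (1 - q ^ i) * s q i j k p - q ^ i * s q (i - 1) j k p =
      q * (g1 q i j k p - g1 q i j k (p + (1, 0, 0))) +
      q * (g2 q i j k p - g2 q i j k (p + (0, 1, 0))) +
      (-q) * (g3 q i j k p - g3 q i j k (p + (0, 0, 1))) +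
      q ^ 2 * (g4 q i j k p - g4 q i j k (p + (1, 1, -1))) := by
  obtain ⟨x, y, z⟩ := p
  have := termwise q hq h1 (i - x - y) (j - x - z) (k - y - z) x y z i
    (i + j + k - x - y - z) (by ring) (by ring)
  simp only [s, g1, g2, g3, g4, Prod.mk_add_mk, add_zero]
  rw [show i - 1 - x - y = i - x - y - 1 by ring,
    show i - 1 + j + k - x - y - z = i + j + k - x - y - z - 1 by ring, this]
  have e1 : i - (x + 1) - y = i - x - y - 1 := by ring
  have e2 : j - (x + 1) - z = j - x - z - 1 := by ring
  have e3 : i - x - (y + 1) = i - x - y - 1 := by ring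
  have e4 : k - (y + 1) - z = k - y - z - 1 := by ring
  have e5 : j - x - (z + 1) = j - x - z - 1 := by ring
  have e6 : k - y - (z + 1) = k - y - z - 1 := by ring
  have e7 : i - (x + 1) - (y + 1) = i - x - y - 2 := by ring
  have e8 : j - (x + 1) - (z + -1) = j - x - z := by ring
  have e9 : k - (y + 1) - (z + -1) = k - y - z := by ring
  have f1 : i + j + k - (x + 1) - y - z = i + j + k - x - y - z - 1 := by ring
  have f2 : i + j + k - x - (y + 1) - z = i + j + k - x - y - z - 1 := by ring
  have f3 : i + j + k - x - y - (z + 1) = i + j + k - x - y - z - 1 := by ring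
  have f4 : i + j + k - (x + 1) - (y + 1) - (z + -1) = i + j + k - x - y - z - 1 := by ring
  have f5 : i - x - y - 1 - 1 = i - x - y - 2 := by ring
  have f6 : i - x - y - 2 - 1 = i - x - y - 3 := by ring
  have f7 : z + -1 = z - 1 := by ring
  simp only [e1, e2, e3, e4, e5, e6, e7, e8, e9, f1, f2, f3, f4, f5, f6,
    add_sub_cancel_right]
  rw [f7]
  ring

lemma F_step (q : K) (hq : q ≠ 0) (h1 : ∀ n : ℕ, 0 < n → q ^ n ≠ 1) (i j k : ℤ) :
    (1 - q ^ i) * ∑ᶠ p, s q i j k p = q ^ i * ∑ᶠ p, s q (i - 1) j k p := by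
  obtain ⟨k1, k2, k3, k4⟩ := g_fin q i j k
  have hs := s_fin q i j k
  have hs' := s_fin q (i - 1) j k
  have m1 : (Function.support fun p => (1 - q ^ i) * s q i j k p).Finite :=
    hs.subset (fun p hp h0 => hp (by simp [h0]))
  have m2 : (Function.support fun p => q ^ i * s q (i - 1) j k p).Finite :=
    hs'.subset (fun p hp h0 => hp (by simp [h0]))
  rw [← sub_eq_zero, mul_finsum' hs, mul_finsum' hs', ← finsum_sub_distrib m1 m2]
  simp only [s_step q hq h1]
  have d1 := fin_supp_diff k1 (1, 0, 0) q
  have d2 := fin_supp_diff k2 (0, 1, 0) q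
  have d3 := fin_supp_diff k3 (0, 0, 1) (-q)
  have d4 := fin_supp_diff k4 (1, 1, -1) (q ^ 2)
  have d12 := (d1.union d2).subset (Function.support_add _ _)
  have d123 := (d12.union d3).subset (Function.support_add _ _)
  rw [finsum_add_distrib d123 d4, finsum_add_distrib d12 d3, finsum_add_distrib d1 d2,
    finsum_diff k1, finsum_diff k2, finsum_diff k3, finsum_diff k4]
  simp

noncomputable def g0 (q : K) (j k : ℤ) (p : ℤ × ℤ × ℤ) : K :=
  if p.1 = 0 ∧ p.2.1 = 0 then
    w q (j + k - p.2.2) * (w q (p.2.2 - 1) * q ^ (p.2.2 - 1) * e q (p.2.2 - 1)) *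
      (e q (j - p.2.2) * e q (k - p.2.2)) -
    w q (j + k - p.2.2) * (w q (p.2.2 - 1) * q ^ (p.2.2 - 1) * e q (p.2.2 - 1)) *
      (e q (j - p.2.2) * e q (k - p.2.2 - 1))
  else 0

lemma w_zero (q : K) : w q 0 = 1 := by simp [w, TZ]

lemma s_zero (q : K) (hq : q ≠ 0) (j k x y z : ℤ) : s q 0 j k (x, y, z) =
    if x = 0 ∧ y = 0 then w q (j + k - z) * w q z * (e q (j - z) * e q (k - z) * e q z)
    else 0 := by
  split_ifs with h
  · obtain ⟨rfl, rfl⟩ := h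
    simp only [s, S, w_zero, e_zero, w_pred q hq, sub_zero, zero_add, zpow_zero]
    have hz : q ^ z ≠ 0 := zpow_ne_zero _ hq
    field_simp
    ring
  · by_contra hn
    have := S_ne q hn
    simp only at this
    omega

lemma g0_fin (q : K) (j k : ℤ) : (Function.support (g0 q j k)).Finite := by
  refine fin_supp _ (|j| + |k| + 5) ?_
  intro x y z h
  have := le_abs_self j
  have := le_abs_self k
  have := abs_nonneg j
  have := abs_nonneg k
  unfold g0 at h
  simp only at h
  split_ifs at h with h0
  · have : 0 ≤ z - 1 ∧ 0 ≤ j - z := by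
      rcases sub_ne_cases h with h | h <;>
      · simp only [ne_eq, mul_eq_zero, not_or] at h
        exact ⟨e_ne q h.1.2.2, e_ne q h.2.1⟩
    omega
  · exact absurd rfl h

lemma s_step0 (q : K) (hq : q ≠ 0) (h1 : ∀ n : ℕ, 0 < n → q ^ n ≠ 1) (j k : ℤ)
    (p : ℤ × ℤ × ℤ) : (1 - q ^ k) * s q 0 j k p - q ^ k * s q 0 j (k - 1) p =
      q * (g0 q j k p - g0 q j k (p + (0, 0, 1))) := by
  obtain ⟨x, y, z⟩ := p
  simp only [s_zero q hq, g0, Prod.mk_add_mk, add_zero]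
  by_cases h : x = 0 ∧ y = 0
  · simp only [h, and_self, if_true]
    have := termwise2 q hq h1 (j - z) (k - z) z k (j + k - z) (by ring) (by ring)
    rw [show k - 1 - z = k - z - 1 by ring, show j + (k - 1) - z = j + k - z - 1 by ring, this,
      show j + k - (z + 1) = j + k - z - 1 by ring, show j - (z + 1) = j - z - 1 by ring,
      show k - (z + 1) - 1 = k - z - 2 by ring, show k - (z + 1) = k - z - 1 by ring,
      add_sub_cancel_right]
  · simp only [h, if_false]
    simp

lemma F_step0 (q : K) (hq : q ≠ 0) (h1 : ∀ n : ℕ, 0 < n → q ^ n ≠ 1) (j k : ℤ) :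
    (1 - q ^ k) * ∑ᶠ p, s q 0 j k p = q ^ k * ∑ᶠ p, s q 0 j (k - 1) p := by
  have hs := s_fin q 0 j k
  have hs' := s_fin q 0 j (k - 1)
  have m1 : (Function.support fun p => (1 - q ^ k) * s q 0 j k p).Finite :=
    hs.subset (fun p hp h0 => hp (by simp [h0]))
  have m2 : (Function.support fun p => q ^ k * s q 0 j (k - 1) p).Finite :=
    hs'.subset (fun p hp h0 => hp (by simp [h0]))
  rw [← sub_eq_zero, mul_finsum' hs, mul_finsum' hs', ← finsum_sub_distrib m1 m2]
  simp only [s_step0 q hq h1]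
  exact finsum_diff (g0_fin q j k) _ _

lemma F_base (q : K) (hq : q ≠ 0) (j : ℤ) : ∑ᶠ p, s q 0 j 0 p = w q j * e q j := by
  rw [finsum_eq_single _ ((0, 0, 0) : ℤ × ℤ × ℤ)]
  · rw [s_zero q hq]; simp [w_zero, e_zero]
  · rintro ⟨x, y, z⟩ hp
    by_contra hn
    have := S_ne q hn
    simp only at this
    apply hp
    simp only [Prod.mk.injEq]
    omega

/-- the common induction: a sequence with the right recursion -/
lemma rec_solve (q : K) (hq : q ≠ 0) (h1 : ∀ n : ℕ, 0 < n → q ^ n ≠ 1) (F : ℤ → K)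
    (h : ∀ n, (1 - q ^ n) * F n = q ^ n * F (n - 1)) (n : ℕ) :
    F n = w q n * e q n * F 0 := by
  induction n with
  | zero => simp [w_zero, e_zero]
  | succ m ih =>
    have h2 := h ((m + 1 : ℕ) : ℤ)
    have hw := w_pred q hq ((m + 1 : ℕ) : ℤ)
    have he := e_pred q h1 ((m + 1 : ℕ) : ℤ)
    have e1 : ((m + 1 : ℕ) : ℤ) - 1 = m := by push_cast; ring
    rw [e1] at h2 hw he
    have h4 : (1 - q ^ ((m + 1 : ℕ) : ℤ)) ≠ 0 := by
      rw [zpow_natCast]; exact sub_ne_zero.2 (h1 (m + 1) (by omega)).symm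
    have h5 : q ^ ((m + 1 : ℕ) : ℤ) ≠ 0 := zpow_ne_zero _ hq
    apply mul_left_cancel₀ h4
    rw [h2, ih, hw, he]
    field_simp

theorem F_eval (q : K) (hq : q ≠ 0) (h1 : ∀ n : ℕ, 0 < n → q ^ n ≠ 1) (i j k : ℕ) :
    ∑ᶠ p, s q i j k p = (w q i * e q i) * ((w q k * e q k) * (w q j * e q j)) := by
  rw [rec_solve q hq h1 (fun n => ∑ᶠ p, s q n j k p) (fun n => F_step q hq h1 n j k) i,
    rec_solve q hq h1 (fun n => ∑ᶠ p, s q 0 j n p) (fun n => F_step0 q hq h1 j n) k,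
    F_base q hq]

lemma TZ_nat (n : ℕ) : TZ n = (T n : ℤ) := by
  unfold TZ T; push_cast; rfl

lemma w_nat (q : K) (n : ℕ) : w q n = q ^ T n := by
  rw [w, TZ_nat, zpow_natCast]

/-- coercion of triples -/
def emb : ℕ × ℕ × ℕ ↪ ℤ × ℤ × ℤ :=
  ⟨fun p => (p.1, p.2.1, p.2.2), by
    rintro ⟨a, b, c⟩ ⟨a', b', c'⟩ h
    simpa using h⟩

theorem F_sum (q : K) (i j k : ℕ) :
    ∑ᶠ p, s q i j k p = ∑ ab ∈ Finset.range (i + 1), ∑ ac ∈ Finset.range (i + 1),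
      ∑ bc ∈ Finset.range (j + 1), s q i j k (ab, ac, bc) := by
  rw [finsum_eq_sum_of_support_subset (s := (Finset.range (i + 1) ×ˢ Finset.range (i + 1) ×ˢ
    Finset.range (j + 1)).map emb)]
  · rw [Finset.sum_map, Finset.sum_product]
    refine Finset.sum_congr rfl fun a _ => ?_
    rw [Finset.sum_product]
    rfl
  · rintro ⟨x, y, z⟩ hp
    have := S_ne q hp
    simp only at this
    simp only [Finset.coe_map, Set.mem_image, Finset.mem_coe, Finset.mem_product,
      Finset.mem_range]
    refine ⟨(x.toNat, y.toNat, z.toNat), by simp only; omega, ?_⟩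
    change ((x.toNat : ℤ), (y.toNat : ℤ), (z.toNat : ℤ)) = (x, y, z)
    rw [Int.toNat_of_nonneg (by omega), Int.toNat_of_nonneg (by omega),
      Int.toNat_of_nonneg (by omega)]

noncomputable abbrev φ : PowerSeries ℚ →+* FractionRing (PowerSeries ℚ) := algebraMap _ _

lemma φ_inj : Function.Injective φ := IsFractionRing.injective _ _

lemma qX_ne : φ X ≠ 0 := by
  rw [ne_eq, map_eq_zero_iff φ φ_inj]; exact PowerSeries.X_ne_zero

lemma qX_pow (n : ℕ) (hn : 0 < n) : φ X ^ n ≠ 1 := by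
  rw [← map_pow, ← map_one φ]
  intro h
  have := congrArg (PowerSeries.constantCoeff) (φ_inj h)
  simp [hn.ne'] at this

lemma φ_inv (n : ℕ) : φ (qpoch n)⁻¹ = e (φ X) n := by
  have hc : PowerSeries.constantCoeff (qpoch n) ≠ 0 := by
    simp [qpoch, map_prod]
  have h := congrArg φ (PowerSeries.mul_inv_cancel _ hc)
  rw [map_mul, map_one] at h
  rw [eq_inv_of_mul_eq_one_right h]
  simp [e, qpoch, map_prod]

end KeyAux

open KeyAux in
/-- The Alladi–Andrews–Gordon Key Identity, as formal power series in `q = X`.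
The sum is over nonnegative integers `a, b, c, ab, ac, bc` satisfying
`i = a + ab + ac`, `j = b + ab + bc`, `k = c + ac + bc` (the summation variables
below are `ab, ac, bc`, which determine `a, b, c`; the ranges cover all solutions),
with `t = a+b+c+ab+ac+bc`.  Note `T (bc - 1)` uses truncated subtraction, so for
`bc = 0` it equals `0 = T_{-1}`. -/
theorem key_identity (i j k : ℕ) :
    (∑ ab ∈ Finset.range (i + 1), ∑ ac ∈ Finset.range (i + 1),
      ∑ bc ∈ Finset.range (j + 1),
        if ab + ac ≤ i ∧ ab + bc ≤ j ∧ ac + bc ≤ k then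
          (let a := i - ab - ac
           let b := j - ab - bc
           let c := k - ac - bc
           let t := a + b + c + ab + ac + bc
           (X : PowerSeries ℚ) ^ (T t + T ab + T ac + T (bc - 1)) *
             (1 - (X : PowerSeries ℚ) ^ a + (X : PowerSeries ℚ) ^ (a + bc)) *
             ((qpoch a)⁻¹ * (qpoch b)⁻¹ * (qpoch c)⁻¹ * (qpoch ab)⁻¹ * (qpoch ac)⁻¹ *
               (qpoch bc)⁻¹))
        else 0) =
      (X : PowerSeries ℚ) ^ (T i + T j + T k) *
        ((qpoch i)⁻¹ * (qpoch j)⁻¹ * (qpoch k)⁻¹) := by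
  apply φ_inj
  have hR : φ ((X : PowerSeries ℚ) ^ (T i + T j + T k) *
        ((qpoch i)⁻¹ * (qpoch j)⁻¹ * (qpoch k)⁻¹)) = ∑ᶠ p, s (φ X) i j k p := by
    rw [F_eval _ qX_ne qX_pow]
    simp only [map_mul, map_pow, φ_inv, w_nat, pow_add]
    ring
  rw [hR, F_sum]
  simp only [map_sum]
  refine Finset.sum_congr rfl fun x _ => Finset.sum_congr rfl fun y _ =>
    Finset.sum_congr rfl fun z _ => ?_
  split_ifs with h
  · obtain ⟨ha, hb, hc⟩ := h
    have e1 : (i : ℤ) - x - y = ((i - x - y : ℕ) : ℤ) := by omega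
    have e2 : (j : ℤ) - x - z = ((j - x - z : ℕ) : ℤ) := by omega
    have e3 : (k : ℤ) - y - z = ((k - y - z : ℕ) : ℤ) := by omega
    have e4 : (i : ℤ) + j + k - x - y - z =
      ((i - x - y + (j - x - z) + (k - y - z) + x + y + z : ℕ) : ℤ) := by omega
    have e5 : w (φ X) ((z : ℤ) - 1) = φ X ^ T (z - 1) := by
      rcases z with _ | z
      · simp [w, TZ, T]
      · rw [← w_nat]; simp
    simp only [s, S]
    rw [e1, e2, e3, e4, e5]
    simp only [← Nat.cast_add, w_nat, zpow_natCast, map_mul, map_add, map_sub, map_one, map_pow,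
      φ_inv, pow_add]
  · rw [map_zero]
    symm
    by_contra hn
    have := S_ne _ hn
    simp only at this
    omega
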